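/- arXiv:2010.08448 — 2 statements merged into one kernel-verified Lean document; each statement's English description precedes it below -/
import Mathlib

section
/- There is an absolute constant C such that for every α ∈ (0, 1/2) and every bounded interval J ⊆ ℝ with |J| > 0: ( (1/|J|) · ∫_J | g_α(y) − (1/|J|)∫_J g_α |² dy )^{1/2} ≤ C · α^{1/4}. -/
open MeasureTheory Set
open scoped ENNReal

noncomputable section

/-- The function `g_α`: equal to `1` on `[-1,1]` and to `|y|^{-α}` outside. -/
def gFun (α : ℝ) (y : ℝ) : ℝ := if |y| ≤ 1 then 1 else |y| ^ (-α)

lemma gFun_eq_max_rpow (α y : ℝ) : gFun α y = (max 1 |y|) ^ (-α) := by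
  unfold gFun
  split_ifs with h
  · rw [max_eq_left h, Real.one_rpow]
  · rw [max_eq_right (not_le.mp h).le]

lemma continuous_gFun (α : ℝ) : Continuous (gFun α) := by
  have h : gFun α = fun y => (max 1 |y|) ^ (-α) := funext (gFun_eq_max_rpow α)
  rw [h]
  exact (continuous_const.max continuous_abs).rpow_const fun y =>
    Or.inl (lt_of_lt_of_le one_pos (le_max_left _ _)).ne'

lemma gFun_le_one {α : ℝ} (hα : 0 ≤ α) (y : ℝ) : gFun α y ≤ 1 := by
  rw [gFun_eq_max_rpow]
  exact Real.rpow_le_one_of_one_le_of_nonpos (le_max_left _ _) (neg_nonpos.mpr hα)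

lemma gFun_nonneg (α y : ℝ) : 0 ≤ gFun α y := by
  rw [gFun_eq_max_rpow]
  positivity

lemma gFun_le_gFun_of_abs_le {α x y : ℝ} (hα : 0 ≤ α) (h : |y| ≤ |x|) :
    gFun α x ≤ gFun α y := by
  simp only [gFun_eq_max_rpow]
  exact Real.rpow_le_rpow_of_nonpos (lt_of_lt_of_le one_pos (le_max_left _ _))
    (max_le_max le_rfl h) (neg_nonpos.mpr hα)

lemma gFun_sub_gFun_le {α M y : ℝ} (hα : 0 ≤ α) (hM : 0 < M) (h : |y| ≤ M) :
    gFun α y - gFun α M ≤ 1 - (|y| / M) ^ α := by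
  have hdiv : (|y| / M) ^ α ≤ 1 :=
    Real.rpow_le_one (by positivity) ((div_le_one hM).mpr h) hα
  rcases le_or_gt M 1 with hM1 | hM1
  · have h1 : gFun α y = 1 := if_pos (h.trans hM1)
    have h2 : gFun α M = 1 := if_pos (by rwa [abs_of_pos hM])
    linarith
  have h2 : gFun α M = M ^ (-α) := by
    rw [gFun_eq_max_rpow, abs_of_pos hM, max_eq_right hM1.le]
  have hy : (|y| / M) ^ α = |y| ^ α * M ^ (-α) := by
    rw [Real.div_rpow (abs_nonneg y) hM.le, Real.rpow_neg hM.le, div_eq_mul_inv]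
  rw [h2, hy]
  rcases le_or_gt |y| 1 with hy1 | hy1
  · have h1 : gFun α y = 1 := if_pos hy1
    have h3 : |y| ^ α ≤ 1 := Real.rpow_le_one (abs_nonneg y) hy1 hα
    have h4 : 0 ≤ M ^ (-α) := by positivity
    nlinarith
  · have h1 : gFun α y = |y| ^ (-α) := if_neg (not_le.mpr hy1)
    have h0 : 0 < |y| := by linarith
    have h3 : |y| ^ (-α) ≤ 1 := h1 ▸ gFun_le_one hα y
    have h4 : |y| ^ (-α) * |y| ^ α = 1 := by
      rw [← Real.rpow_add h0]; simp
    rw [hy] at hdiv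
    rw [h1]
    have h5 : |y| ^ (-α) - M ^ (-α) = |y| ^ (-α) * (1 - |y| ^ α * M ^ (-α)) := by
      linear_combination M ^ (-α) * h4
    rw [h5]
    exact mul_le_of_le_one_left (by linarith) h3

lemma continuous_one_sub_abs_div_rpow {α : ℝ} (hα : 0 ≤ α) (M : ℝ) :
    Continuous fun y : ℝ => 1 - (|y| / M) ^ α :=
  continuous_const.sub ((continuous_abs.div_const M).rpow_const fun _ => Or.inr hα)

lemma integral_one_sub_abs_div_rpow_le {α M : ℝ} (hα : 0 ≤ α) (hM : 0 < M) :
    ∫ y in (-M)..M, (1 - (|y| / M) ^ α) ≤ 2 * M * α := by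
  have hc := continuous_one_sub_abs_div_rpow hα M
  have hpos : ∫ y in (0:ℝ)..M, (1 - (|y| / M) ^ α) = M - M / (1 + α) := by
    have h1 : ∫ y in (0:ℝ)..M, (1 - (|y| / M) ^ α) =
        ∫ y in (0:ℝ)..M, (fun t : ℝ => 1 - t ^ α) (y / M) := by
      refine intervalIntegral.integral_congr fun y hy => ?_
      rw [uIcc_of_le hM.le] at hy
      simp only [abs_of_nonneg hy.1]
    rw [h1, intervalIntegral.integral_comp_div (fun t : ℝ => 1 - t ^ α) hM.ne', zero_div,
      div_self hM.ne', intervalIntegral.integral_sub (by simp)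
        (intervalIntegral.intervalIntegrable_rpow' (by linarith)),
      integral_rpow (Or.inl (by linarith))]
    have h2 : α + 1 ≠ 0 := by linarith
    simp only [intervalIntegral.integral_const, Real.one_rpow, Real.zero_rpow h2, smul_eq_mul]
    rw [add_comm 1 α]
    ring
  have hneg : ∫ y in (-M)..0, (1 - (|y| / M) ^ α) = M - M / (1 + α) := by
    rw [← hpos]
    simpa using (intervalIntegral.integral_comp_neg (a := 0) (b := M)
      fun y : ℝ => 1 - (|y| / M) ^ α).symm
  rw [← intervalIntegral.integral_add_adjacent_intervals (hc.intervalIntegrable (-M) 0)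
    (hc.intervalIntegrable 0 M), hneg, hpos]
  have h3 : M - M / (1 + α) = M * α / (1 + α) := by
    field_simp
    ring
  have h4 : M * α / (1 + α) ≤ M * α := div_le_self (by positivity) (by linarith)
  linarith

lemma one_sub_rpow_le_of_half_le {α t : ℝ} (hα : 0 ≤ α) (ht : 1 / 2 ≤ t) :
    1 - t ^ α ≤ α := by
  have h1 : ((1:ℝ) / 2) ^ α ≤ t ^ α := Real.rpow_le_rpow (by norm_num) ht hα
  have h2 : ((1:ℝ) / 2) ^ α = Real.exp (-(Real.log 2 * α)) := by
    rw [Real.rpow_def_of_pos (by norm_num), one_div, Real.log_inv, neg_mul]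
  have h3 := Real.add_one_le_exp (-(Real.log 2 * α))
  have h4 : Real.log 2 ≤ 1 := by linarith [Real.log_two_lt_d9]
  nlinarith

lemma integral_one_sub_abs_div_rpow_le_mul_sub {α a b : ℝ} (hα : 0 ≤ α) (hab : a < b) :
    ∫ y in a..b, (1 - (|y| / max |a| |b|) ^ α) ≤ 4 * α * (b - a) := by
  set M := max |a| |b|
  have haM : |a| ≤ M := le_max_left _ _
  have hbM : |b| ≤ M := le_max_right _ _
  have hM : 0 < M := by
    by_contra! h
    have ha := abs_nonpos_iff.mp (haM.trans h)
    have hb := abs_nonpos_iff.mp (hbM.trans h)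
    linarith
  have hc := continuous_one_sub_abs_div_rpow hα M
  rcases le_or_gt M (2 * (b - a)) with h | h
  · have hmono : ∫ y in a..b, (1 - (|y| / M) ^ α) ≤ ∫ y in (-M)..M, (1 - (|y| / M) ^ α) := by
      refine intervalIntegral.integral_mono_interval (neg_le_of_abs_le haM) hab.le
        (le_of_abs_le hbM) ?_ (hc.intervalIntegrable _ _)
      refine ae_restrict_of_forall_mem measurableSet_Ioc fun y hy => ?_
      have hy' : |y| ≤ M := abs_le.mpr ⟨hy.1.le, hy.2⟩
      exact sub_nonneg.mpr (Real.rpow_le_one (by positivity) ((div_le_one hM).mpr hy') hα)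
    have := integral_one_sub_abs_div_rpow_le hα hM
    nlinarith
  · have hmono : ∫ y in a..b, (1 - (|y| / M) ^ α) ≤ ∫ _ in a..b, α := by
      refine intervalIntegral.integral_mono_on hab.le (hc.intervalIntegrable _ _) (by simp)
        fun y hy => one_sub_rpow_le_of_half_le hα ?_
      rw [le_div_iff₀ hM]
      rcases max_choice |a| |b| with hm | hm
      · have h1 := abs_sub_abs_le_abs_sub a y
        rw [abs_sub_comm, abs_of_nonneg (sub_nonneg.mpr hy.1)] at h1
        linarith [hy.2]
      · have h1 := abs_sub_abs_le_abs_sub b y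
        rw [abs_of_nonneg (sub_nonneg.mpr hy.2)] at h1
        linarith [hy.1]
    rw [intervalIntegral.integral_const, smul_eq_mul] at hmono
    nlinarith [mul_nonneg hα (sub_nonneg.mpr hab.le)]

lemma integral_sq_sub_average_le {f : ℝ → ℝ} (hf : Continuous f) {a b c : ℝ} (hab : a < b)
    (hc : 0 ≤ c) (hcf : ∀ y ∈ Icc a b, c ≤ f y) (hf1 : ∀ y ∈ Icc a b, f y ≤ 1) :
    ∫ y in a..b, (f y - (b - a)⁻¹ * ∫ z in a..b, f z) ^ 2 ≤ 2 * ∫ y in a..b, (f y - c) := by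
  have hba : 0 < b - a := sub_pos.mpr hab
  set m := (b - a)⁻¹ * ∫ z in a..b, f z with hm
  have hint : ∫ z in a..b, f z = (b - a) * m := by
    rw [hm, mul_inv_cancel_left₀ hba.ne']
  have hcm : c ≤ m := by
    have h := intervalIntegral.integral_mono_on hab.le (by simp : IntervalIntegrable
      (fun _ => c) volume a b) (hf.intervalIntegrable a b) hcf
    rw [intervalIntegral.integral_const, smul_eq_mul, hint] at h
    exact le_of_mul_le_mul_left h hba
  have hm1 : m ≤ 1 := by
    have h := intervalIntegral.integral_mono_on hab.le (hf.intervalIntegrable a b)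
      (by simp : IntervalIntegrable (fun _ => (1:ℝ)) volume a b) hf1
    rw [intervalIntegral.integral_const, smul_eq_mul, hint] at h
    exact le_of_mul_le_mul_left h hba
  have hmono : ∫ y in a..b, (f y - m) ^ 2 ≤ ∫ y in a..b, (f y + (m - 2 * c)) := by
    refine intervalIntegral.integral_mono_on hab.le
      (((hf.sub continuous_const).pow 2).intervalIntegrable _ _)
      ((hf.add continuous_const).intervalIntegrable _ _) fun y hy => ?_
    have h1 := hcf y hy
    have h2 := hf1 y hy
    rcases le_total m (f y) with h | h <;> nlinarith
  refine hmono.trans (le_of_eq ?_)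
  rw [intervalIntegral.integral_add (hf.intervalIntegrable _ _) (by simp),
    intervalIntegral.integral_sub (hf.intervalIntegrable _ _) (by simp),
    intervalIntegral.integral_const, intervalIntegral.integral_const, smul_eq_mul, smul_eq_mul,
    hint]
  ring

/-- Claim 3.5 of the paper (Claim 2): the L² oscillation of `g_α` over any bounded
interval is at most a universal constant times `α^{1/4}`, for `α ∈ (0,1/2)`. -/
theorem oscillation_g_alpha :
    ∃ C : ℝ, 0 < C ∧
      ∀ α : ℝ, α ∈ Ioo (0:ℝ) (1/2) →
        ∀ a b : ℝ, a < b →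
          Real.sqrt ((b - a)⁻¹ *
              ∫ y in Ico a b, (gFun α y - (b - a)⁻¹ * ∫ z in Ico a b, gFun α z) ^ 2) ≤
            C * α ^ ((1:ℝ)/4) := by
  refine ⟨3, by norm_num, fun α ⟨hα, hα2⟩ a b hab => ?_⟩
  have hba : 0 < b - a := sub_pos.mpr hab
  simp only [integral_Ico_eq_integral_Ioc, ← intervalIntegral.integral_of_le hab.le]
  set M := max |a| |b|
  have hyM : ∀ y ∈ Icc a b, |y| ≤ M := fun y hy => abs_le_max_abs_abs hy.1 hy.2
  have hM0 : 0 ≤ M := (abs_nonneg a).trans (le_max_left _ _)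
  have hM : 0 < M := by
    refine hM0.lt_of_ne fun h => hab.ne ?_
    have ha := abs_nonpos_iff.mp ((hyM a (left_mem_Icc.mpr hab.le)).trans h.ge)
    have hb := abs_nonpos_iff.mp ((hyM b (right_mem_Icc.mpr hab.le)).trans h.ge)
    rw [ha, hb]
  have h1 := integral_sq_sub_average_le (continuous_gFun α) hab (gFun_nonneg α M)
    (fun y hy => gFun_le_gFun_of_abs_le hα.le ((hyM y hy).trans (le_abs_self M)))
    (fun y _ => gFun_le_one hα.le y)
  have h2 : ∫ y in a..b, (gFun α y - gFun α M) ≤ ∫ y in a..b, (1 - (|y| / M) ^ α) :=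
    intervalIntegral.integral_mono_on hab.le
      (((continuous_gFun α).sub continuous_const).intervalIntegrable _ _)
      ((continuous_one_sub_abs_div_rpow hα.le M).intervalIntegrable _ _)
      fun y hy => gFun_sub_gFun_le hα.le hM (hyM y hy)
  have h3 := integral_one_sub_abs_div_rpow_le_mul_sub hα.le hab
  have h4 : α ≤ (α ^ ((1:ℝ)/4)) ^ 2 := by
    rw [← Real.rpow_natCast, ← Real.rpow_mul hα.le]
    exact Real.self_le_rpow_of_le_one hα.le (by linarith) (by norm_num)
  refine Real.sqrt_le_iff.mpr ⟨by positivity, ?_⟩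
  rw [inv_mul_le_iff₀ hba]
  have h5 := mul_le_mul_of_nonneg_left h4 hba.le
  have h6 : 0 ≤ (b - a) * α := by positivity
  linarith
end
end

section
/- Let α ∈ (0, 1/2) and define F : ℝ² → ℝ by F(x,y) := h_{[1,2)}(x) · g_α(y), where h_{[1,2)} is the Haar wavelet of the interval [1,2). Then for every θ ∈ (0, 2π) with θ ∉ {π/2, π, 3π/2}, there exists a dyadic rectangle R = I×J (I,J ∈ 𝔻) such that |⟨F ∘ φ^θ, h_R⟩| ≥ |R|^{1/2}/16, i.e. the normalized coefficient satisfies |R|^{−1/2}·|⟨F ∘ φ^θ, h_R⟩| ≥ 1/16. -/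
open MeasureTheory Set
open scoped ENNReal NNReal

noncomputable section

/-- L²-normalized Haar wavelet of the interval `[a, b)`. -/
def haarW (a b : ℝ) (x : ℝ) : ℝ :=
  (Real.sqrt (b - a))⁻¹ *
    ((Ico a ((a + b) / 2)).indicator 1 x - (Ico ((a + b) / 2) b).indicator 1 x)

/-- Haar coefficient of `F : ℝ² → ℝ` on the rectangle `[a,b) × [c,d)`. -/
def haarCoef2 (F : ℝ × ℝ → ℝ) (a b c d : ℝ) : ℝ :=
  ∫ p : ℝ × ℝ, F p * (haarW a b p.1 * haarW c d p.2)

/-- Left endpoint of the dyadic interval `2^k • [j, j+1)`. -/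
def dyadL (k j : ℤ) : ℝ := (2:ℝ) ^ k * (j : ℝ)

/-- Right endpoint of the dyadic interval `2^k • [j, j+1)`. -/
def dyadR (k j : ℤ) : ℝ := (2:ℝ) ^ k * ((j : ℝ) + 1)

/-- Rotation of the plane by angle `θ`. -/
def rot (θ : ℝ) (p : ℝ × ℝ) : ℝ × ℝ :=
  (p.1 * Real.cos θ - p.2 * Real.sin θ, p.1 * Real.sin θ + p.2 * Real.cos θ)

lemma integrable_haarW (a b : ℝ) : Integrable (haarW a b) := by
  have h : ∀ u v : ℝ, Integrable ((Ico u v).indicator (1 : ℝ → ℝ)) := fun u v =>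
    (integrable_indicator_iff measurableSet_Ico).2 (integrableOn_const (by simp))
  exact ((h _ _).sub (h _ _)).const_mul _

lemma measurable_haarW (a b : ℝ) : Measurable (haarW a b) :=
  ((measurable_one.indicator measurableSet_Ico).sub
    (measurable_one.indicator measurableSet_Ico)).const_mul _

lemma haarW_eq_zero {a b x : ℝ} (hab : a ≤ b) (hx : x ∉ Ico a b) : haarW a b x = 0 := by
  have h1 : x ∉ Ico a ((a + b) / 2) := fun h => hx ⟨h.1, by linarith [h.2]⟩
  have h2 : x ∉ Ico ((a + b) / 2) b := fun h => hx ⟨by linarith [h.1], h.2⟩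
  simp [haarW, h1, h2]

lemma measurable_gFun (α : ℝ) : Measurable (gFun α) :=
  Measurable.ite (measurableSet_le measurable_norm measurable_const) measurable_const
    (measurable_norm.pow_const _)

lemma abs_gFun_le_one {α : ℝ} (hα : 0 < α) (y : ℝ) : |gFun α y| ≤ 1 := by
  unfold gFun
  split_ifs with h
  · simp
  · rw [abs_of_nonneg (by positivity)]
    exact Real.rpow_le_one_of_one_le_of_nonpos (by linarith) (by linarith)

lemma abs_haarW_one_two_le_one (x : ℝ) : |haarW 1 2 x| ≤ 1 := by
  norm_num [haarW, indicator_apply]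
  split_ifs <;> norm_num

lemma haarW_one_two_of_lt {x : ℝ} (h : 1 ≤ x) (h' : x < 3 / 2) : haarW 1 2 x = 1 := by
  have h2 : x ∉ Ico ((1 + 2 : ℝ) / 2) 2 := fun h => by linarith [h.1]
  have h1 : x ∈ Ico (1 : ℝ) ((1 + 2 : ℝ) / 2) := ⟨h, by linarith⟩
  rw [haarW, indicator_of_mem h1, indicator_of_notMem h2]
  norm_num

lemma haarW_one_two_of_ge {x : ℝ} (h : 3 / 2 ≤ x) (h' : x < 2) : haarW 1 2 x = -1 := by
  have h1 : x ∉ Ico (1 : ℝ) ((1 + 2 : ℝ) / 2) := fun h => by linarith [h.2]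
  have h2 : x ∈ Ico ((1 + 2 : ℝ) / 2) 2 := ⟨by linarith, h'⟩
  rw [haarW, indicator_of_mem h2, indicator_of_notMem h1]
  norm_num

/-- Pairing of a Haar wavelet with a function that jumps from `e` to `-e` in its left half. -/
lemma integral_jump_mul_haarW {a b t e : ℝ} {f : ℝ → ℝ} (hat : a ≤ t) (htm : t ≤ (a + b) / 2)
    (hlt : ∀ x ∈ Ico a b, x < t → f x = e) (hgt : ∀ x ∈ Ico a b, t < x → f x = -e) :
    ∫ x, f x * haarW a b x = (Real.sqrt (b - a))⁻¹ * (2 * e * (t - a)) := by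
  have hi : ∀ u v : ℝ, Integrable ((Ico u v).indicator (1 : ℝ → ℝ)) := fun u v =>
    (integrable_indicator_iff measurableSet_Ico).2 (integrableOn_const (by simp))
  have key : (fun x => f x * haarW a b x) =ᵐ[volume] fun x => (Real.sqrt (b - a))⁻¹ * e *
      ((Ico a t).indicator 1 x - (Ico t ((a + b) / 2)).indicator 1 x
        + (Ico ((a + b) / 2) b).indicator 1 x) := by
    have hne : ∀ᵐ x : ℝ, x ≠ t := by simp [ae_iff]
    filter_upwards [hne] with x hx
    by_cases hxI : x ∈ Ico a b
    · rcases lt_or_gt_of_ne hx with h | h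
      · rw [hlt x hxI h]
        have h1 : x < (a + b) / 2 := by linarith
        simp [haarW, hxI.1, hxI.2, h, h1, not_le.2 h, not_le.2 h1]
        ring
      · rw [hgt x hxI h]
        simp only [haarW, indicator_apply, mem_Ico, hxI.1, hxI.2, h.le, not_lt.2 h.le]
        by_cases h1 : x < (a + b) / 2
        · simp [h1, not_le.2 h1]; ring
        · simp [h1, not_lt.1 h1]; ring
    · rw [haarW_eq_zero (by linarith) hxI]
      have h1 : x ∉ Ico a t := fun h => hxI ⟨h.1, by linarith [h.2]⟩
      have h2 : x ∉ Ico t ((a + b) / 2) := fun h => hxI ⟨by linarith [h.1], by linarith [h.2]⟩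
      have h3 : x ∉ Ico ((a + b) / 2) b := fun h => hxI ⟨by linarith [h.1], h.2⟩
      simp [h1, h2, h3]
  rw [integral_congr_ae key, integral_const_mul,
    integral_add (f := fun x => (Ico a t).indicator 1 x - (Ico t ((a + b) / 2)).indicator 1 x)
      ((hi _ _).sub (hi _ _)) (hi _ _), integral_sub (hi _ _) (hi _ _)]
  simp only [integral_indicator_one measurableSet_Ico, measureReal_def, Real.volume_Ico]
  rw [ENNReal.toReal_ofReal (by linarith), ENNReal.toReal_ofReal (by linarith),
    ENNReal.toReal_ofReal (by linarith)]
  ring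

lemma integral_haarW_mul_affine {a b : ℝ} (hab : a ≤ b) (p q : ℝ) :
    ∫ y, haarW a b y * (p + q * y) = -((Real.sqrt (b - a))⁻¹ * (q * (b - a) ^ 2 / 4)) := by
  have hi : ∀ u v : ℝ, Integrable ((Ico u v).indicator fun y : ℝ => p + q * y) := fun u v =>
    (integrable_indicator_iff measurableSet_Ico).2
      ((Continuous.integrableOn_Icc (by fun_prop)).mono_set Ico_subset_Icc_self)
  have hI : ∀ u v : ℝ, u ≤ v → ∫ y, (Ico u v).indicator (fun y : ℝ => p + q * y) y =
      p * (v - u) + q * ((v ^ 2 - u ^ 2) / 2) := fun u v huv => by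
    rw [integral_indicator measurableSet_Ico, integral_Ico_eq_integral_Ioc,
      ← intervalIntegral.integral_of_le huv, intervalIntegral.integral_add
        (by simp) (Continuous.intervalIntegrable (by fun_prop) _ _),
      intervalIntegral.integral_const_mul, integral_id]
    simp
    ring
  have key : (fun y => haarW a b y * (p + q * y)) = fun y => (Real.sqrt (b - a))⁻¹ *
      ((Ico a ((a + b) / 2)).indicator (fun y : ℝ => p + q * y) y -
        (Ico ((a + b) / 2) b).indicator (fun y : ℝ => p + q * y) y) := by
    ext y
    simp only [haarW, indicator_apply, Pi.one_apply]
    split_ifs <;> ring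
  rw [key, integral_const_mul, integral_sub (hi _ _) (hi _ _), hI _ _ (by linarith),
    hI _ _ (by linarith)]
  ring

/-- Haar coefficient of a bounded function that, on the rectangle, jumps from `e` to `-e` across
the line `x = p + q * y`, when this line stays in the left half of the rectangle. -/
lemma haarCoef2_of_jump {F : ℝ × ℝ → ℝ} {a b c d p q e : ℝ} (hF : Measurable F)
    (hF1 : ∀ z, |F z| ≤ 1) (hcd : c ≤ d)
    (hline : ∀ y ∈ Ico c d, a ≤ p + q * y ∧ p + q * y ≤ (a + b) / 2)
    (hlt : ∀ x ∈ Ico a b, ∀ y ∈ Ico c d, x < p + q * y → F (x, y) = e)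
    (hgt : ∀ x ∈ Ico a b, ∀ y ∈ Ico c d, p + q * y < x → F (x, y) = -e) :
    haarCoef2 F a b c d = -((Real.sqrt (b - a))⁻¹ * (Real.sqrt (d - c))⁻¹ *
      (e * q * (d - c) ^ 2 / 2)) := by
  have h_integrable : Integrable (fun z : ℝ × ℝ => F z * (haarW a b z.1 * haarW c d z.2))
      (volume.prod volume) :=
    ((integrable_haarW a b).mul_prod (integrable_haarW c d)).bdd_mul
      hF.aestronglyMeasurable (Filter.Eventually.of_forall hF1)
  have hslice : ∀ y, ∫ x, F (x, y) * (haarW a b x * haarW c d y) =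
      (Real.sqrt (b - a))⁻¹ * (haarW c d y * (2 * e * (p - a) + 2 * e * q * y)) := by
    intro y
    by_cases hy : y ∈ Ico c d
    · have := integral_jump_mul_haarW (f := fun x => F (x, y)) (e := e) (hline y hy).1
        (hline y hy).2 (fun x hx h => hlt x hx y hy h) (fun x hx h => hgt x hx y hy h)
      simp only [← mul_assoc, integral_mul_const] at this ⊢
      rw [this]
      ring
    · simp [haarW_eq_zero hcd hy]
  rw [haarCoef2, Measure.volume_eq_prod, integral_prod_symm _ h_integrable]
  simp only [hslice]
  rw [integral_const_mul, integral_haarW_mul_affine hcd]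
  ring

/-- A line that meets short steps crosses some grid row near the left of a given interval. -/
lemma exists_row_crossing {ℓ q L : ℝ} (hℓ : 0 < ℓ) (hq : q ≠ 0) (hL : 4 * (ℓ * |q|) ≤ L)
    (a p : ℝ) :
    ∃ j : ℤ, ∀ y ∈ Ico (ℓ * (j : ℝ)) (ℓ * ((j : ℝ) + 1)),
      a ≤ p + q * y ∧ p + q * y ≤ a + L / 2 := by
  rcases lt_or_gt_of_ne hq with hq | hq
  · rw [abs_of_neg hq] at hL
    have hm : 0 < ℓ * -q := by nlinarith
    refine ⟨⌊(p - a) / (ℓ * -q)⌋ - 1, fun y hy => ?_⟩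
    have h1 := (le_div_iff₀ hm).1 (Int.floor_le ((p - a) / (ℓ * -q)))
    have h2 := (div_lt_iff₀ hm).1 (Int.lt_floor_add_one ((p - a) / (ℓ * -q)))
    push_cast at hy
    constructor <;> nlinarith [hy.1, hy.2]
  · rw [abs_of_pos hq] at hL
    have hm : 0 < ℓ * q := by positivity
    refine ⟨⌈(a - p) / (ℓ * q)⌉, fun y hy => ?_⟩
    have h1 := (div_le_iff₀ hm).1 (Int.le_ceil ((a - p) / (ℓ * q)))
    have h2 := (lt_div_iff₀ hm).1 (sub_lt_iff_lt_add.2 (Int.ceil_lt_add_one ((a - p) / (ℓ * q))))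
    constructor <;> nlinarith [hy.1, hy.2]

/-- Near the image of the point `(3/2, 0)` the rotated tensor takes the values `±1`. -/
lemma rotated_tensor_near (α θ : ℝ) {x y : ℝ} (hx : |x - 3 / 2 * Real.cos θ| ≤ 1 / 8)
    (hy : |y + 3 / 2 * Real.sin θ| ≤ 1 / 8) :
    haarW 1 2 (rot θ (x, y)).1 * gFun α (rot θ (x, y)).2 =
      if x * Real.cos θ - y * Real.sin θ < 3 / 2 then 1 else -1 := by
  have hcs := Real.sin_sq_add_cos_sq θ
  have hb : ∀ u v : ℝ, |u| ≤ 1 → |v| ≤ 1 / 8 → |u * v| ≤ 1 / 8 := fun u v hu hv => by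
    rw [abs_mul]
    nlinarith [abs_nonneg u, abs_nonneg v]
  have h1 := abs_le.1 (hb _ _ (Real.abs_cos_le_one θ) hx)
  have h2 := abs_le.1 (hb _ _ (Real.abs_sin_le_one θ) hy)
  have h3 := abs_le.1 (hb _ _ (Real.abs_sin_le_one θ) hx)
  have h4 := abs_le.1 (hb _ _ (Real.abs_cos_le_one θ) hy)
  have hg : gFun α (rot θ (x, y)).2 = 1 := by
    refine if_pos (abs_le.2 ⟨?_, ?_⟩) <;> simp only [rot] <;> nlinarith
  rw [hg, mul_one]
  split_ifs with h
  · exact haarW_one_two_of_lt (by simp only [rot]; nlinarith) h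
  · exact haarW_one_two_of_ge (not_lt.1 h) (by simp only [rot]; nlinarith)

/-- The exact-Haar case of Lemma 3.6 of the paper (Property C): the rotation of
`F(x,y) = h_{[1,2)}(x)·g_α(y)` has a uniformly large normalized rectangular Haar
coefficient. -/
theorem rotated_tensor_large_coefficient (α : ℝ) (hα : α ∈ Ioo (0:ℝ) (1/2)) (θ : ℝ)
    (hθ : θ ∈ Ioo 0 (2 * Real.pi))
    (h₁ : θ ≠ Real.pi / 2) (h₂ : θ ≠ Real.pi) (h₃ : θ ≠ 3 * Real.pi / 2) :
    ∃ k₁ j₁ k₂ j₂ : ℤ,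
      Real.sqrt ((2:ℝ) ^ k₁ * (2:ℝ) ^ k₂) / 16 ≤
        |haarCoef2 (fun q : ℝ × ℝ => haarW 1 2 (rot θ q).1 * gFun α (rot θ q).2)
          (dyadL k₁ j₁) (dyadR k₁ j₁) (dyadL k₂ j₂) (dyadR k₂ j₂)| := by
  have hpi := Real.pi_pos
  have hs : Real.sin θ ≠ 0 := by
    intro h
    obtain ⟨n, hn⟩ := Real.sin_eq_zero_iff.1 h
    have h0 : (0 : ℝ) < n := by nlinarith [hθ.1]
    have h2 : (n : ℝ) < 2 := by nlinarith [hθ.2]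
    norm_cast at h0 h2
    obtain rfl : n = 1 := by omega
    exact h₂ (by rw [← hn]; simp)
  have hc : Real.cos θ ≠ 0 := by
    intro h
    obtain ⟨n, hn⟩ := Real.cos_eq_zero_iff.1 h
    have h0 : (-1 : ℝ) < n := by nlinarith [hθ.1]
    have h2 : (n : ℝ) < 2 := by nlinarith [hθ.2]
    norm_cast at h2
    have h0 : (-1 : ℤ) < n := by exact_mod_cast h0
    obtain rfl | rfl : n = 0 ∨ n = 1 := by omega
    · apply h₁
      rw [hn]; push_cast; ring
    · apply h₃
      rw [hn]; push_cast; ring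
  have near := fun x y hx hy => @rotated_tensor_near α θ x y hx hy
  have hcs := Real.sin_sq_add_cos_sq θ
  have hrot : Measurable (rot θ) := by unfold rot; fun_prop
  have hFm : Measurable fun q : ℝ × ℝ => haarW 1 2 (rot θ q).1 * gFun α (rot θ q).2 :=
    ((measurable_haarW 1 2).comp hrot.fst).mul ((measurable_gFun α).comp hrot.snd)
  have hF1 : ∀ q, |haarW 1 2 (rot θ q).1 * gFun α (rot θ q).2| ≤ 1 := fun q => by
    rw [abs_mul]
    exact mul_le_one₀ (abs_haarW_one_two_le_one _) (abs_nonneg _) (abs_gFun_le_one hα.1 _)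
  generalize Real.cos θ = c at *
  generalize Real.sin θ = s at *
  have hq : s / c ≠ 0 := div_ne_zero hs hc
  have hq' : 0 < |s / c| := abs_pos.2 hq
  obtain ⟨n, hn1, hn2⟩ := exists_mem_Ico_zpow (y := (2 : ℝ)) (x := 8 * |s / c|)
    (by positivity) (by norm_num)
  rw [zpow_add_one₀ (by norm_num)] at hn2
  obtain ⟨k, hk1, hk2⟩ : ∃ k : ℤ, (2 : ℝ) ^ k ≤ 1 / 64 ∧ (2 : ℝ) ^ (k + n) ≤ 1 / 8 := by
    refine ⟨min (-6) (-3 - n), ?_, ?_⟩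
    · calc (2 : ℝ) ^ (min (-6) (-3 - n)) ≤ 2 ^ (-6 : ℤ) :=
            zpow_le_zpow_right₀ (by norm_num) (min_le_left _ _)
        _ = 1 / 64 := by norm_num
    · calc (2 : ℝ) ^ (min (-6) (-3 - n) + n) ≤ 2 ^ (-3 : ℤ) :=
            zpow_le_zpow_right₀ (by norm_num) (by omega)
        _ = 1 / 8 := by norm_num
  have hL : (2 : ℝ) ^ (k + n) = 2 ^ k * 2 ^ n := zpow_add₀ (by norm_num) _ _
  have hℓ0 : (0 : ℝ) < 2 ^ k := by positivity
  have hL0 : (0 : ℝ) < 2 ^ (k + n) := by positivity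
  have hLlo : 4 * ((2 : ℝ) ^ k * |s / c|) ≤ 2 ^ (k + n) := by rw [hL]; nlinarith
  have hLhi : (2 : ℝ) ^ (k + n) ≤ 8 * ((2 : ℝ) ^ k * |s / c|) := by rw [hL]; nlinarith
  generalize hLd : (2 : ℝ) ^ (k + n) = L at *
  generalize hℓd : (2 : ℝ) ^ k = ℓ at *
  have hi1 := (le_div_iff₀ hL0).1 (Int.floor_le (3 / 2 * c / L))
  have hi2 := (div_lt_iff₀ hL0).1 (Int.lt_floor_add_one (3 / 2 * c / L))
  generalize ⌊3 / 2 * c / L⌋ = i at *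
  obtain ⟨j, hj⟩ := exists_row_crossing hℓ0 hq hLlo (L * i) (3 / 2 / c)
  have hxnear : ∀ x ∈ Ico (L * (i : ℝ)) (L * (i + 1)), |x - 3 / 2 * c| ≤ 1 / 8 := fun x hx =>
    abs_le.2 ⟨by nlinarith [hx.1], by nlinarith [hx.2]⟩
  have hynear : ∀ y ∈ Ico (ℓ * (j : ℝ)) (ℓ * (j + 1)), |y + 3 / 2 * s| ≤ 1 / 8 := by
    intro y hy
    have h : |s / c| * |y + 3 / 2 * s| ≤ L := by
      rw [← abs_mul]
      have : s / c * (y + 3 / 2 * s) = 3 / 2 / c + s / c * y - 3 / 2 * c := by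
        field_simp
        linear_combination 3 * hcs
      rw [this]
      exact abs_le.2 ⟨by nlinarith [(hj y hy).1], by nlinarith [(hj y hy).2]⟩
    have h' : |s / c| * |y + 3 / 2 * s| ≤ |s / c| * (8 * ℓ) := by linarith
    linarith [le_of_mul_le_mul_left h' hq']
  obtain ⟨e, he, hlt, hgt⟩ : ∃ e : ℝ, |e| = 1 ∧
      (∀ x y, x < 3 / 2 / c + s / c * y → (if x * c - y * s < 3 / 2 then (1 : ℝ) else -1) = e) ∧
      (∀ x y, 3 / 2 / c + s / c * y < x →
        (if x * c - y * s < 3 / 2 then (1 : ℝ) else -1) = -e) := by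
    have hform : ∀ y, 3 / 2 / c + s / c * y = (3 / 2 + s * y) / c := fun y => by ring
    simp only [hform]
    rcases lt_or_gt_of_ne hc with hc | hc
    · refine ⟨-1, by norm_num, fun x y h => if_neg ?_, fun x y h => ?_⟩
      · rw [lt_div_iff_of_neg hc] at h
        linarith
      · rw [div_lt_iff_of_neg hc] at h
        rw [if_pos (by linarith), neg_neg]
    · refine ⟨1, by norm_num, fun x y h => if_pos ?_, fun x y h => if_neg ?_⟩
      · rw [lt_div_iff₀ hc] at h
        linarith
      · rw [div_lt_iff₀ hc] at h
        linarith
  refine ⟨k + n, i, k, j, ?_⟩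
  simp only [dyadL, dyadR, hLd, hℓd]
  rw [haarCoef2_of_jump (p := 3 / 2 / c) (q := s / c) (e := e) hFm hF1
    (by linarith) (fun y hy => ⟨(hj y hy).1, by linarith [(hj y hy).2]⟩)
    (fun x hx y hy h => (near x y (hxnear x hx) (hynear y hy)).trans (hlt x y h))
    (fun x hx y hy h => (near x y (hxnear x hx) (hynear y hy)).trans (hgt x y h))]
  have hd1 : L * ((i : ℝ) + 1) - L * i = L := by ring
  have hd2 : ℓ * ((j : ℝ) + 1) - ℓ * j = ℓ := by ring
  rw [hd1, hd2, abs_neg, ← mul_inv, ← Real.sqrt_mul hL0.le, abs_mul, abs_div, abs_mul, abs_mul,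
    he, abs_of_nonneg (by positivity : (0 : ℝ) ≤ (Real.sqrt (L * ℓ))⁻¹), abs_two,
    abs_of_nonneg (sq_nonneg ℓ), inv_mul_eq_div, le_div_iff₀ (by positivity),
    div_mul_eq_mul_div, Real.mul_self_sqrt (by positivity)]
  nlinarith
end
end
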